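/- (Additivity of coding entropy.) In the standing setting, let ℱ be a finite family of nonempty subsets of X∖{∞} with M(∪ℱ) < +∞. Then h_pol(f; ∪ℱ) = h_pol(f; ℱ), where h_pol(f; ∪ℱ) denotes the coding entropy of the singleton family {∪ℱ}. -/

import Mathlib

open Filter Topology Set
open scoped ENNReal

/-- `E` is `(n, ε)`-separated for `f`: any two distinct points of `E` are `ε`-apart at some
time `k ∈ {0, …, n-1}`. -/
def IsDynSeparated {X : Type*} [MetricSpace X] (f : X → X) (n : ℕ) (ε : ℝ) (E : Set X) : Prop :=
  ∀ x ∈ E, ∀ y ∈ E, x ≠ y → ∃ k < n, ε < dist (f^[k] x) (f^[k] y)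

/-- `S(n, ε)`: the maximal cardinality of an `(n, ε)`-separated set. -/
noncomputable def maxSep {X : Type*} [MetricSpace X] (f : X → X) (n : ℕ) (ε : ℝ) : ℕ :=
  sSup {m | ∃ E : Finset X, IsDynSeparated f n ε ↑E ∧ E.card = m}

/-- Polynomial entropy `h_pol(f) = lim_{ε → 0} limsup_n (log S(n,ε) / log n)`, a value in
`[0, ∞]`.  Since `ε ↦ limsup_n (log S(n,ε) / log n)` is nonincreasing in `ε`, the limit as
`ε → 0⁺` is the supremum over `ε > 0`. -/
noncomputable def polEntropy {X : Type*} [MetricSpace X] (f : X → X) : ℝ≥0∞ :=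
  ⨆ (ε : ℝ) (_ : 0 < ε),
    Filter.atTop.limsup fun n : ℕ =>
      ENNReal.ofReal (Real.log (maxSep f n ε) / Real.log n)

/-- Topological entropy `h_top(f) = lim_{ε → 0} limsup_n (1/n) log S(n,ε)`. -/
noncomputable def topEntropy {X : Type*} [MetricSpace X] (f : X → X) : ℝ≥0∞ :=
  ⨆ (ε : ℝ) (_ : 0 < ε),
    Filter.atTop.limsup fun n : ℕ =>
      ENNReal.ofReal (Real.log (maxSep f n ε) / n)

/-- The set `A_n(ℱ)` of codings of orbit segments of length `n` relative to the finite
family `ℱ`: words `w` with letters in `ℱ ∪ {∞_ℱ}` (where `∞_ℱ` is the complement of `∪ℱ`)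
for which some orbit segment `(x, f x, …, f^{n-1} x)` satisfies `f^k x ∈ w k` for all `k`. -/
def codings {X : Type*} (f : X → X) (F : Finset (Set X)) (n : ℕ) : Set (Fin n → Set X) :=
  {w | (∀ k, w k ∈ F ∨ w k = (⋃₀ (F : Set (Set X)))ᶜ) ∧
      ∃ x : X, ∀ k : Fin n, f^[(k : ℕ)] x ∈ w k}

/-- Coding polynomial entropy of a finite family: `h_pol(f; ℱ) = limsup_n log #A_n(ℱ) / log n`.
For a single set `Y`, `h_pol(f; Y)` is `codingEntropy f {Y}`. -/
noncomputable def codingEntropy {X : Type*} (f : X → X) (F : Finset (Set X)) : ℝ≥0∞ :=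
  Filter.atTop.limsup fun n : ℕ =>
    ENNReal.ofReal (Real.log ((codings f F n).ncard) / Real.log n)

/-- The `n`-th iterate of a homeomorphism, for `n : ℤ`. -/
def zIter {X : Type*} [TopologicalSpace X] (f : X ≃ₜ X) (n : ℤ) (x : X) : X :=
  (f.toEquiv ^ n) x

/-- A set `Z` is wandering if `f^n(Z) ∩ Z = ∅` for every integer `n ≠ 0`. -/
def IsWanderingSet {X : Type*} [TopologicalSpace X] (f : X ≃ₜ X) (Z : Set X) : Prop :=
  ∀ n : ℤ, n ≠ 0 → zIter f n '' Z ∩ Z = ∅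

/-- Standing setting: `p` (the point written `∞` in the paper) is a fixed point of `f`, and
every other point is wandering, i.e. has a wandering neighborhood. -/
def StandingSetting {X : Type*} [TopologicalSpace X] (f : X ≃ₜ X) (p : X) : Prop :=
  f p = p ∧ ∀ x : X, x ≠ p → ∃ U ∈ 𝓝 x, IsWanderingSet f U

/-- `M(Y) = sup_{x ∈ X} #{n ∈ ℤ : f^n(x) ∈ Y}`. -/
noncomputable def orbitCount {X : Type*} [TopologicalSpace X] (f : X ≃ₜ X) (Y : Set X) : ℕ∞ :=
  ⨆ x : X, {n : ℤ | zIter f n x ∈ Y}.encard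

/-- Local polynomial entropy `h^loc_pol(f; S)` of a finite set `S`: the limit, along
decreasing neighborhood bases of the points of `S`, of the coding entropies of the
corresponding families of neighborhoods.  By monotonicity of the coding entropy this limit
equals the infimum of `h_pol(f; {U x : x ∈ S})` over all families `U` of respective
neighborhoods of the points of `S` such that `M(⋃_{x ∈ S} U x) < ∞` (such families exist,
and any decreasing neighborhood basis eventually consists of such sets). -/
noncomputable def localEntropy {X : Type*} [TopologicalSpace X] (f : X ≃ₜ X)
    (S : Finset X) : ℝ≥0∞ :=
  letI := Classical.decEq (Set X)
  ⨅ (U : X → Set X) (_ : ∀ x ∈ S, U x ∈ 𝓝 x)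
    (_ : orbitCount f (⋃ x ∈ S, U x) < ⊤),
    codingEntropy ⇑f (S.image U)

/-- The family `U` of sets (indexed by the points of `S`) is mutually singular: for every
`M` there are a point `x` and times `(N a)_{a ∈ S}` with `f^{N a}(x) ∈ U a` for all `a ∈ S`
and `|N a - N b| > M` for all `a ≠ b` in `S`. -/
def MutuallySingularFam {X : Type*} [TopologicalSpace X] (f : X ≃ₜ X) (S : Finset X)
    (U : X → Set X) : Prop :=
  ∀ M : ℕ, ∃ (x : X) (N : X → ℤ),
    (∀ a ∈ S, zIter f (N a) x ∈ U a) ∧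
    ∀ a ∈ S, ∀ b ∈ S, a ≠ b → (M : ℤ) < |N a - N b|

/-- A finite set `S` is singular if every family of respective neighborhoods of its points
is mutually singular. -/
def IsSingularSet {X : Type*} [TopologicalSpace X] (f : X ≃ₜ X) (S : Finset X) : Prop :=
  ∀ U : X → Set X, (∀ a ∈ S, U a ∈ 𝓝 a) → MutuallySingularFam f S U

/-- The codings relative to a finite family form a finite set. -/
theorem finite_codings {X : Type*} (f : X → X) (F : Finset (Set X)) (n : ℕ) :
    (codings f F n).Finite := by
  classical
  refine (Fintype.piFinset fun _ : Fin n =>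
    insert (⋃₀ (F : Set (Set X)))ᶜ F).finite_toSet.subset ?_
  rintro w ⟨hw, -⟩
  simpa [Fintype.mem_piFinset, or_comm] using hw

/-- The nonnegative iterates in `zIter` are the ordinary iterates. -/
theorem zIter_natCast {X : Type*} [TopologicalSpace X] (f : X ≃ₜ X) (n : ℕ) (x : X) :
    zIter f n x = f^[n] x := by
  rw [zIter, zpow_natCast, Equiv.Perm.coe_pow]
  rfl

open Classical in
/-- Forget which element of the family a letter is, retaining only whether it belongs to it. -/
noncomputable def mergeLetters {X : Type*} (F : Finset (Set X)) {n : ℕ} (w : Fin n → Set X) :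
    Fin n → Set X :=
  fun k => if w k ∈ F then ⋃₀ (F : Set (Set X)) else (⋃₀ (F : Set (Set X)))ᶜ

theorem image_mergeLetters_codings {X : Type*} (f : X → X) {F : Finset (Set X)} {p : X}
    (hF : ∀ Y ∈ F, p ∉ Y) (n : ℕ) :
    mergeLetters F '' codings f F n = codings f {⋃₀ (F : Set (Set X))} n := by
  classical
  have hp : p ∈ (⋃₀ (F : Set (Set X)))ᶜ := fun ⟨Y, hY, hpY⟩ => hF Y hY hpY
  have hcompl : (⋃₀ (F : Set (Set X)))ᶜ ∉ F := fun h => hF _ h hp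
  ext v
  constructor
  · rintro ⟨w, ⟨hw, x, hx⟩, rfl⟩
    refine ⟨fun k => ?_, x, fun k => ?_⟩
    · by_cases h : w k ∈ F <;> simp [mergeLetters, h]
    · by_cases h : w k ∈ F
      · simp only [mergeLetters, h, if_true]
        exact ⟨w k, h, hx k⟩
      · simp only [mergeLetters, h, if_false]
        exact (hw k).resolve_left h ▸ hx k
  · rintro ⟨hv, x, hx⟩
    have hletter : ∀ k : Fin n, ∃ Z : Set X, (Z ∈ F ∨ Z = (⋃₀ (F : Set (Set X)))ᶜ) ∧
        f^[(k : ℕ)] x ∈ Z ∧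
        (if Z ∈ F then ⋃₀ (F : Set (Set X)) else (⋃₀ (F : Set (Set X)))ᶜ) = v k := by
      intro k
      have hk := hx k
      rcases hv k with h | h
      · rw [Finset.mem_singleton] at h
        rw [h] at hk
        obtain ⟨Z, hZ, hxZ⟩ := hk
        exact ⟨Z, Or.inl hZ, hxZ, by rw [if_pos (Finset.mem_coe.1 hZ), h]⟩
      · simp only [Finset.coe_singleton, sUnion_singleton] at h
        exact ⟨_, Or.inr rfl, h ▸ hk, by rw [if_neg hcompl, h]⟩
    choose w hw hxw hwv using hletter
    exact ⟨w, ⟨hw, x, hxw⟩, funext hwv⟩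

/-- If the orbits visit `⋃₀ F` at most `M` times, then merging letters is at most
`(#F + 1) ^ M`-to-one on codings. -/
theorem ncard_codings_le {X : Type*} (f : X → X) {F : Finset (Set X)} {p : X}
    (hF : ∀ Y ∈ F, p ∉ Y) {M : ℕ}
    (hM : ∀ x, {k : ℕ | f^[k] x ∈ ⋃₀ (F : Set (Set X))}.encard ≤ M) (n : ℕ) :
    (codings f F n).ncard ≤
      (F.card + 1) ^ M * (codings f {⋃₀ (F : Set (Set X))} n).ncard := by
  classical
  rw [← image_mergeLetters_codings f hF n]
  have hfin := finite_codings f F n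
  rw [ncard_eq_toFinset_card _ hfin, ncard_eq_toFinset_card _ (hfin.image _),
    hfin.toFinset_image]
  refine Finset.card_le_mul_card_image _ _ fun v hv => ?_
  rw [Finset.mem_image] at hv
  obtain ⟨w₀, hw₀, rfl⟩ := hv
  obtain ⟨hletters, x, hx⟩ := hfin.mem_toFinset.1 hw₀
  have hmem : ∀ w : Fin n → Set X, mergeLetters F w = mergeLetters F w₀ →
      ∀ k, w k ∈ F ↔ w₀ k ∈ F := by
    intro w hw k
    have hne : ⋃₀ (F : Set (Set X)) ≠ (⋃₀ (F : Set (Set X)))ᶜ := fun h => by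
      have hp : p ∉ ⋃₀ (F : Set (Set X)) := fun ⟨Y, hY, hpY⟩ => hF Y hY hpY
      exact hp (h ▸ hp)
    have := congrFun hw k
    by_cases h : w k ∈ F <;> by_cases h₀ : w₀ k ∈ F <;>
      simp only [mergeLetters, h, h₀, if_true, if_false] at this ⊢
    · exact (hne this).elim
    · exact (hne this.symm).elim
  have hsub : hfin.toFinset.filter (fun w => mergeLetters F w = mergeLetters F w₀) ⊆
      Fintype.piFinset fun k : Fin n =>
        if w₀ k ∈ F then F else {(⋃₀ (F : Set (Set X)))ᶜ} := by
    intro w hw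
    rw [Finset.mem_filter, hfin.mem_toFinset] at hw
    rw [Fintype.mem_piFinset]
    intro k
    have hk := hmem w hw.2 k
    split_ifs with h
    · exact hk.2 h
    · exact Finset.mem_singleton.2 ((hw.1.1 k).resolve_left fun h' => h (hk.1 h'))
  have hvisits : (Finset.univ.filter fun k : Fin n => w₀ k ∈ F).card ≤ M := by
    have hle := hM x
    have himage : Fin.val '' ((Finset.univ.filter fun k : Fin n => w₀ k ∈ F : Finset (Fin n)) :
        Set (Fin n)) ⊆ {k : ℕ | f^[k] x ∈ ⋃₀ (F : Set (Set X))} := by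
      rintro _ ⟨k, hk, rfl⟩
      exact ⟨w₀ k, (Finset.mem_filter.1 (Finset.mem_coe.1 hk)).2, hx k⟩
    have h := (encard_le_encard himage).trans hle
    rw [Fin.val_injective.encard_image, encard_coe_eq_coe_finsetCard] at h
    exact_mod_cast h
  calc _ ≤ _ := Finset.card_le_card hsub
    _ = F.card ^ (Finset.univ.filter fun k : Fin n => w₀ k ∈ F).card := by
      rw [Fintype.card_piFinset, ← Finset.prod_const, Finset.prod_filter]
      exact Finset.prod_congr rfl fun k _ => by split_ifs <;> simp
    _ ≤ (F.card + 1) ^ (Finset.univ.filter fun k : Fin n => w₀ k ∈ F).card :=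
      Nat.pow_le_pow_left (Nat.le_succ _) _
    _ ≤ (F.card + 1) ^ M := Nat.pow_le_pow_right (Nat.succ_pos _) hvisits

/-- A bounded multiplicative factor does not affect polynomial growth rates. -/
theorem limsup_log_div_log_le {a b : ℕ → ℕ} {C : ℕ} (h : ∀ n, b n ≤ C * a n) :
    (atTop.limsup fun n : ℕ => ENNReal.ofReal (Real.log (b n) / Real.log n)) ≤
      atTop.limsup fun n : ℕ => ENNReal.ofReal (Real.log (a n) / Real.log n) := by
  have hC : Tendsto (fun n : ℕ => ENNReal.ofReal (Real.log C / Real.log n)) atTop (𝓝 0) := by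
    have := (Real.tendsto_log_atTop.comp tendsto_natCast_atTop_atTop).const_div_atTop (Real.log C)
    simpa using ENNReal.tendsto_ofReal this
  calc _ ≤ atTop.limsup ((fun n : ℕ => ENNReal.ofReal (Real.log C / Real.log n)) +
        fun n : ℕ => ENNReal.ofReal (Real.log (a n) / Real.log n)) := by
        refine limsup_le_limsup (Eventually.of_forall fun n => ?_)
        rcases Nat.eq_zero_or_pos (b n) with hb | hb
        · simp [hb]
        have hpos : 0 < C * a n := hb.trans_le (h n)
        have hC0 : (C : ℝ) ≠ 0 := by exact_mod_cast (Nat.pos_of_mul_pos_right hpos).ne'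
        have ha0 : (a n : ℝ) ≠ 0 := by exact_mod_cast (Nat.pos_of_mul_pos_left hpos).ne'
        refine le_trans (ENNReal.ofReal_le_ofReal ?_) ENNReal.ofReal_add_le
        rw [← add_div, ← Real.log_mul hC0 ha0]
        gcongr
        · exact_mod_cast h n
    _ = _ := ENNReal.limsup_add_of_left_tendsto_zero hC _

/-- additivity of coding entropy: if `M(∪ℱ) < ∞` then
`h_pol(f; ∪ℱ) = h_pol(f; ℱ)`. -/
theorem codingEntropy_sUnion {X : Type*} [MetricSpace X] [CompactSpace X]
    (f : X ≃ₜ X) (p : X) (hst : StandingSetting f p)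
    (F : Finset (Set X))
    (hF : ∀ Y ∈ F, Y.Nonempty ∧ p ∉ Y)
    (hM : orbitCount f (⋃₀ (F : Set (Set X))) < ⊤) :
    codingEntropy ⇑f {⋃₀ (F : Set (Set X))} = codingEntropy ⇑f F := by
  obtain ⟨M, hM'⟩ := ENat.ne_top_iff_exists.1 hM.ne
  have hF' : ∀ Y ∈ F, p ∉ Y := fun Y hY => (hF Y hY).2
  have hvisits : ∀ x, {k : ℕ | (⇑f)^[k] x ∈ ⋃₀ (F : Set (Set X))}.encard ≤ M := by
    intro x
    rw [hM']
    refine le_trans ?_ (le_iSup (fun x : X =>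
      {n : ℤ | zIter f n x ∈ ⋃₀ (F : Set (Set X))}.encard) x)
    rw [← Nat.cast_injective (R := ℤ).encard_image]
    refine encard_le_encard ?_
    rintro _ ⟨k, hk, rfl⟩
    simpa only [mem_ofPred_eq, zIter_natCast] using hk
  apply le_antisymm
  · refine limsup_log_div_log_le (C := 1) fun n => ?_
    rw [one_mul, ← image_mergeLetters_codings (⇑f) hF' n]
    exact ncard_image_le (finite_codings (⇑f) F n)
  · exact limsup_log_div_log_le (ncard_codings_le (⇑f) hF' hvisits)
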